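/- Let N ≥ 1 and let θ₁,…,θ_N, κ₁,…,κ_N ∈ ℝ and a₁,…,a_N, b₁,…,b_N ∈ ℂ with |a_j| < 1 and |b_j| < 1 for all j. Then there exist θ'₁,…,θ'_N, κ'₁,…,κ'_N ∈ ℝ and a'₁,…,a'_N, b'₁,…,b'_N ∈ ℂ with |a'_j| < 1 and |b'_j| < 1 for all j, such that for every λ ∈ ℝ \ {0} the alternating product E₋(κ₁,b₁,λ)·E₊(θ₁,a₁,λ)·E₋(κ₂,b₂,λ)·E₊(θ₂,a₂,λ)···E₋(κ_N,b_N,λ)·E₊(θ_N,a_N,λ) equals the separated product [E₋(κ'₁,b'₁,λ)···E₋(κ'_N,b'_N,λ)]·[E₊(θ'₁,a'₁,λ)···E₊(θ'_N,a'_N,λ)], i.e., a product of N minus-type matrices followed by a product of N plus-type matrices. -/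

import Mathlib

open Matrix

/-- The "plus-type" factor `E₊(θ,a,λ)`. -/
noncomputable def Ep (θ : ℝ) (a : ℂ) (lam : ℝ) : Matrix (Fin 2) (Fin 2) ℂ :=
  (((Real.sqrt (1 + ‖a‖ ^ 2 * lam ^ 2))⁻¹ : ℝ) : ℂ) •
    !![Complex.exp (Complex.I * θ), a * lam;
       -(starRingEnd ℂ a) * lam, Complex.exp (-(Complex.I * θ))]

/-- The "minus-type" factor `E₋(κ,b,λ)`. -/
noncomputable def Em (κ : ℝ) (b : ℂ) (lam : ℝ) : Matrix (Fin 2) (Fin 2) ℂ :=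
  (((Real.sqrt (1 + ‖b‖ ^ 2 * ((lam : ℝ) ^ 2)⁻¹))⁻¹ : ℝ) : ℂ) •
    !![Complex.exp (Complex.I * κ), b * (lam : ℂ)⁻¹;
       -(starRingEnd ℂ b) * (lam : ℂ)⁻¹, Complex.exp (-(Complex.I * κ))]

theorem swap_core (u v ui vi w wb e ei a ac b bc l : ℂ) (hl : l ≠ 0) (hu : u * ui = 1) (hv : v * vi = 1)
    (he : e * ei = 1) (hw : w = 1 - u * v * ac * b) (hwb : wb = 1 - ui * vi * a * bc)
    (h1 : e * w = v * wb) (h2 : ei * wb = vi * w) :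
    !![u, a * l; -ac * l, ui] * !![v, b * l⁻¹; -bc * l⁻¹, vi] =
    !![e, (u * u * b) * l⁻¹; -(ui * ui * bc) * l⁻¹, ei] *
      !![u, (a * vi * ei) * l; -(ac * v * e) * l, ui] := by
  have hll : l * l⁻¹ = 1 := mul_inv_cancel₀ hl
  generalize l⁻¹ = m at *
  subst hw hwb
  ext i j
  fin_cases i <;> fin_cases j <;> simp [Matrix.mul_apply, Fin.sum_univ_two]
  · linear_combination (-a * bc + u*u*b*ac*v*e) * hll - u * h1 + v * vi * a * bc * hu + a * bc * hv
  · linear_combination (-a * vi * l) * he - (u * b * m) * hu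
  · linear_combination (ac * v * l) * he + (ui * bc * m) * hu
  · linear_combination (-ac * b + ui*ui*bc*a*vi*ei) * hll - ui * h2 + v * vi * ac * b * hu + ac * b * hv

theorem swap_lemma (θ κ : ℝ) (a b : ℂ) (ha : ‖a‖ < 1) (hb : ‖b‖ < 1) :
    ∃ (θ' κ' : ℝ) (a' b' : ℂ), ‖a'‖ < 1 ∧ ‖b'‖ < 1 ∧ ∀ lam : ℝ, lam ≠ 0 →
      Ep θ a lam * Em κ b lam = Em κ' b' lam * Ep θ' a' lam := by
  have hconj : ∀ t : ℝ, (starRingEnd ℂ) (Complex.exp (Complex.I * t)) =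
      Complex.exp (-(Complex.I * t)) := by
    intro t
    rw [← Complex.exp_conj]; simp
  have hconj' : ∀ t : ℝ, (starRingEnd ℂ) (Complex.exp (-(Complex.I * t))) =
      Complex.exp (Complex.I * t) := by
    intro t
    rw [← Complex.exp_conj]; simp
  have hn : ∀ t : ℝ, ‖Complex.exp (Complex.I * t)‖ = 1 := by
    intro t
    rw [mul_comm]; exact Complex.norm_exp_ofReal_mul_I t
  have hn' : ∀ t : ℝ, ‖Complex.exp (-(Complex.I * t))‖ = 1 := by
    intro t
    rw [← hconj, Complex.norm_conj, hn]
  have hmul : ∀ t : ℝ, Complex.exp (Complex.I * t) * Complex.exp (-(Complex.I * t)) = 1 := by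
    intro t
    rw [← Complex.exp_add]; simp
  obtain ⟨w, hw⟩ : ∃ w : ℂ, w = 1 - Complex.exp (Complex.I * θ) * Complex.exp (Complex.I * κ) *
      (starRingEnd ℂ) a * b := ⟨_, rfl⟩
  have hwb : (starRingEnd ℂ) w = 1 - Complex.exp (-(Complex.I * θ)) *
      Complex.exp (-(Complex.I * κ)) * a * (starRingEnd ℂ) b := by
    rw [hw]; simp only [map_sub, map_one, map_mul, hconj, Complex.conj_conj]
  have hpolar : (‖w‖ : ℂ) * Complex.exp (Complex.I * w.arg) = w := by
    rw [mul_comm Complex.I]; exact Complex.norm_mul_exp_arg_mul_I w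
  have hpolarb : (‖w‖ : ℂ) * Complex.exp (-(Complex.I * w.arg)) = (starRingEnd ℂ) w := by
    conv_rhs => rw [← hpolar]
    rw [map_mul, hconj, Complex.conj_ofReal]
  have hE : Complex.exp (Complex.I * ((κ - 2 * w.arg : ℝ) : ℂ)) =
      Complex.exp (Complex.I * κ) * Complex.exp (-(Complex.I * w.arg)) *
        Complex.exp (-(Complex.I * w.arg)) := by
    rw [← Complex.exp_add, ← Complex.exp_add]; congr 1; push_cast; ring
  have h1 : Complex.exp (Complex.I * ((κ - 2 * w.arg : ℝ) : ℂ)) * w =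
      Complex.exp (Complex.I * κ) * (starRingEnd ℂ) w := by
    rw [hE, ← hpolarb]
    conv_lhs => rw [← hpolar]
    have := hmul w.arg
    simp only [hpolar]
    rw [show Complex.exp (Complex.I * κ) * Complex.exp (-(Complex.I * w.arg)) *
        Complex.exp (-(Complex.I * w.arg)) * w = Complex.exp (Complex.I * κ) * Complex.exp (-(Complex.I * w.arg)) *
        Complex.exp (-(Complex.I * w.arg)) * ((‖w‖ : ℂ) * Complex.exp (Complex.I * w.arg)) by rw [hpolar]]
    linear_combination (Complex.exp (Complex.I * κ) * Complex.exp (-(Complex.I * w.arg)) * (‖w‖ : ℂ)) * this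
  have h2 := congrArg (starRingEnd ℂ) h1
  simp only [map_mul, hconj, Complex.conj_conj] at h2
  have na : ‖a * Complex.exp (-(Complex.I * κ)) *
      Complex.exp (-(Complex.I * ((κ - 2 * w.arg : ℝ) : ℂ)))‖ = ‖a‖ := by
    rw [norm_mul, norm_mul, hn', hn', mul_one, mul_one]
  have nb : ‖Complex.exp (Complex.I * θ) * Complex.exp (Complex.I * θ) * b‖ = ‖b‖ := by
    rw [norm_mul, norm_mul, hn, one_mul, one_mul]
  refine ⟨θ, κ - 2 * w.arg, _, _, na.trans_lt ha, nb.trans_lt hb, ?_⟩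
  intro lam hlam
  have hl : (lam : ℂ) ≠ 0 := by exact_mod_cast hlam
  unfold Ep Em
  rw [na, nb, smul_mul_smul_comm, smul_mul_smul_comm, mul_comm (Complex.ofReal _) (Complex.ofReal _)]
  congr 1
  simp only [map_mul, hconj, hconj']
  exact swap_core _ _ _ _ w _ _ _ _ _ _ _ _ hl (hmul _) (hmul _) (hmul _) hw hwb h1 h2

theorem move_lemma (n : ℕ) : ∀ (θ : ℝ) (a : ℂ) (κ : Fin n → ℝ) (b : Fin n → ℂ), ‖a‖ < 1 →
    (∀ j, ‖b j‖ < 1) →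
    ∃ (θ' : ℝ) (a' : ℂ) (κ' : Fin n → ℝ) (b' : Fin n → ℂ), ‖a'‖ < 1 ∧ (∀ j, ‖b' j‖ < 1) ∧
      ∀ lam : ℝ, lam ≠ 0 →
        Ep θ a lam * (List.ofFn (fun j => Em (κ j) (b j) lam)).prod =
          (List.ofFn (fun j => Em (κ' j) (b' j) lam)).prod * Ep θ' a' lam := by
  induction n with
  | zero =>
    intro θ a κ b ha hb
    exact ⟨θ, a, κ, b, ha, hb, fun lam _ => by simp⟩
  | succ n ih =>
    intro θ a κ b ha hb
    obtain ⟨θ₁, κ₁, a₁, b₁, ha₁, hb₁, h₁⟩ := swap_lemma θ (κ 0) a (b 0) ha (hb 0)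
    obtain ⟨θ₂, a₂, κ₂, b₂, ha₂, hb₂, h₂⟩ := ih θ₁ a₁ (fun j => κ j.succ) (fun j => b j.succ) ha₁
      (fun j => hb j.succ)
    refine ⟨θ₂, a₂, Fin.cons κ₁ κ₂, Fin.cons b₁ b₂, ha₂, ?_, ?_⟩
    · intro j
      refine Fin.cases ?_ (fun i => ?_) j
      · simpa using hb₁
      · simpa using hb₂ i
    · intro lam hl
      simp only [List.ofFn_succ, List.prod_cons, Fin.cons_zero, Fin.cons_succ]
      rw [← mul_assoc, h₁ lam hl, mul_assoc, h₂ lam hl, mul_assoc]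

/-- The Birkhoff-factorization algorithm of Section 3: any alternating product
`E₋E₊E₋E₊⋯E₋E₊` of `N` minus/plus pairs can be rewritten as a product of `N`
minus-type matrices followed by a product of `N` plus-type matrices. -/
theorem alternating_product_factorization (N : ℕ) (hN : 1 ≤ N)
    (θ κ : Fin N → ℝ) (a b : Fin N → ℂ)
    (ha : ∀ j, ‖a j‖ < 1) (hb : ∀ j, ‖b j‖ < 1) :
    ∃ (θ' κ' : Fin N → ℝ) (a' b' : Fin N → ℂ),
      (∀ j, ‖a' j‖ < 1) ∧ (∀ j, ‖b' j‖ < 1) ∧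
      ∀ lam : ℝ, lam ≠ 0 →
        (List.ofFn (fun j => Em (κ j) (b j) lam * Ep (θ j) (a j) lam)).prod =
          (List.ofFn (fun j => Em (κ' j) (b' j) lam)).prod *
            (List.ofFn (fun j => Ep (θ' j) (a' j) lam)).prod := by
  clear hN
  induction N with
  | zero => exact ⟨θ, κ, a, b, ha, hb, fun lam _ => by simp⟩
  | succ n ih =>
    obtain ⟨θ₁, κ₁, a₁, b₁, ha₁, hb₁, h₁⟩ := ih (fun j => θ j.succ) (fun j => κ j.succ)
      (fun j => a j.succ) (fun j => b j.succ) (fun j => ha j.succ) (fun j => hb j.succ)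
    obtain ⟨θ₂, a₂, κ₂, b₂, ha₂, hb₂, h₂⟩ := move_lemma n (θ 0) (a 0) κ₁ b₁ (ha 0) hb₁
    refine ⟨Fin.cons θ₂ θ₁, Fin.cons (κ 0) κ₂, Fin.cons a₂ a₁, Fin.cons (b 0) b₂, ?_, ?_, ?_⟩
    · intro j
      refine Fin.cases ?_ (fun i => ?_) j
      · simpa using ha₂
      · simpa using ha₁ i
    · intro j
      refine Fin.cases ?_ (fun i => ?_) j
      · simpa using hb 0
      · simpa using hb₂ i
    · intro lam hl
      simp only [List.ofFn_succ, List.prod_cons, Fin.cons_zero, Fin.cons_succ]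
      rw [h₁ lam hl, mul_assoc, ← mul_assoc (Ep _ _ _), h₂ lam hl]
      simp only [mul_assoc]
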